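/- arXiv:math/0212280 — 2 statements merged into one kernel-verified Lean document; each statement's English description precedes it below -/
import Mathlib

section
/- Let p be an odd prime and let P be a nonabelian group of order p³ and exponent p (the extraspecial p-group of order p³ and exponent p). Then P acts freely (every element acting by a homeomorphism) on the product of spheres S^{2p−1} × S^{2p−3}. -/
open Metric

/-- `Sph n` is the unit sphere `S^n`, i.e. the set of unit vectors in `ℝ^{n+1}`. -/
abbrev Sph (n : ℕ) : Type := Metric.sphere (0 : EuclideanSpace ℝ (Fin (n + 1))) 1

/-- The self-homeomorphisms of a topological space form a group under composition.
A continuous action of a group `G` on `X` (every element acting by a homeomorphism)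
is then precisely a group homomorphism `G →* (X ≃ₜ X)`. -/
instance homeoGroup (X : Type*) [TopologicalSpace X] : Group (X ≃ₜ X) where
  mul e f := f.trans e
  one := Homeomorph.refl X
  inv := Homeomorph.symm
  mul_assoc _ _ _ := Homeomorph.ext fun _ => rfl
  one_mul _ := Homeomorph.ext fun _ => rfl
  mul_one _ := Homeomorph.ext fun _ => rfl
  inv_mul_cancel e := Homeomorph.ext fun x => e.symm_apply_apply x

section Completion

open Matrix

theorem exists_isUnit_diagonal_mul_add_smul {R ι : Type*} [CommRing R] [Fintype ι]
    [DecidableEq ι] (i₀ : ι) {a d : R} (h : IsCoprime a d) (s : Finset ι) (hs : i₀ ∉ s) :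
    ∃ E E' Y : Matrix ι ι R, E * E' = 1 ∧
      diagonal (fun i => if i = i₀ then a ^ (s.card + 1) else if i ∈ s then 1 else a) * E + d • Y
        = a • (1 : Matrix ι ι R) := by
  obtain ⟨u, e, hue⟩ := h
  obtain ⟨b, e, hbe⟩ : ∃ b e : R, a * b + d * e * (d * e) = 1 :=
    ⟨u * (1 + d * e), e, by linear_combination (1 + d * e) * hue⟩
  induction s using Finset.induction_on with
  | empty =>
    refine ⟨1, 1, 0, by simp, ?_⟩
    ext i j
    by_cases hij : i = j <;> simp [diagonal, hij]
  | insert j s hj ih =>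
    have hij : i₀ ≠ j := fun h => hs (by simp [h])
    have hi : i₀ ∉ s := fun h => hs (by simp [h])
    obtain ⟨E, E', Y, hE, hY⟩ := ih hi
    let W : Matrix ι ι R := 1 + single i₀ i₀ (b - 1) + single i₀ j (-(d * e))
      + single j i₀ (d * e) + single j j (a - 1)
    let W' : Matrix ι ι R := 1 + single i₀ i₀ (a - 1) + single i₀ j (d * e)
      + single j i₀ (-(d * e)) + single j j (b - 1)
    let Y' : Matrix ι ι R := single i₀ i₀ (a ^ (s.card + 1) * (d * e ^ 2))
      + single i₀ j (a ^ (s.card + 2) * e) - single j i₀ e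
    have hW : W * W' = 1 := by
      have h1 : W * W' = 1 + single i₀ i₀ (a * b + d * e * (d * e) - 1)
          + single j j (a * b + d * e * (d * e) - 1) := by
        simp only [W, W', mul_add, add_mul, one_mul, mul_one, single_mul_single_same,
          single_mul_single_of_ne _ _ _ _ hij, single_mul_single_of_ne _ _ _ _ hij.symm]
        ext k l
        simp only [Matrix.add_apply, single_apply, Matrix.one_apply, Matrix.zero_apply]
        clear hbe hue ih hY hE
        split_ifs <;> ring
      rw [h1, hbe]; simp
    have hD : diagonal (fun i => if i = i₀ then a ^ (s.card + 1) else if i ∈ s then 1 else a)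
        = diagonal (fun i => if i = i₀ then a ^ ((insert j s).card + 1) else
          if i ∈ insert j s then 1 else a) * W + d • Y' := by
      ext k l
      rw [Matrix.add_apply, diagonal_mul, Finset.card_insert_of_notMem hj]
      simp only [W, Y', diagonal_apply, Matrix.add_apply, Matrix.sub_apply, Matrix.smul_apply,
        single_apply, Matrix.one_apply, smul_eq_mul, Finset.mem_insert]
      by_cases hk : k = i₀
      · subst hk
        by_cases hl : l = k
        · subst hl
          simp [hij.symm]
          linear_combination -a ^ (s.card + 1) * hbe
        · by_cases hl' : l = j
          · subst hl'; simp [hij, hij.symm]; ring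
          · simp [hij.symm, Ne.symm hl, Ne.symm hl']
      · by_cases hk' : k = j
        · subst hk'
          by_cases hl : l = i₀
          · subst hl; simp [hij, hij.symm, hj]
          · by_cases hl' : l = k
            · subst hl'; simp [hij, hij.symm, hj]
            · simp [hij, hij.symm, Ne.symm hl, Ne.symm hl', hj]
        · by_cases hl' : k = l <;> simp [hl', hk, hk', Ne.symm hk, Ne.symm hk']
          simp [← hl', hk, hk', Ne.symm hk, Ne.symm hk']
    refine ⟨W * E, E' * W', Y' * E + Y, ?_, ?_⟩
    · rw [mul_assoc, ← mul_assoc E, hE, one_mul, hW]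
    · rw [← hY, hD, add_mul _ (d • Y') E, smul_add, smul_mul_assoc, mul_assoc, add_assoc]

theorem exists_completion_snoc_pow {R : Type*} [CommRing R] {n : ℕ} {a : R}
    (α : Matrix (Fin (n + 1)) (Fin (n + 1)) R) (h : IsCoprime a α.det) :
    ∃ Q M : Matrix (Fin (n + 2)) (Fin (n + 2)) R, Q * M = 1 ∧
      M 0 = Fin.snoc (α := fun _ => R) (α 0) (a ^ (n + 1)) := by
  obtain ⟨E, E', Y, hE, hY⟩ :=
    exists_isUnit_diagonal_mul_add_smul (0 : Fin (n + 1)) h (Finset.univ.erase 0)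
      (Finset.notMem_erase _ _)
  have hE' : E' * E = 1 := mul_eq_one_comm.mp hE
  have hcard : (Finset.univ.erase (0 : Fin (n + 1))).card + 1 = n + 1 := by simp
  rw [hcard] at hY
  set B : Matrix (Fin (n + 1)) (Fin (n + 1)) R := diagonal _ with hB
  have hB0 (u : Fin (n + 1) → R) : (B *ᵥ u) 0 = a ^ (n + 1) * u 0 := by
    simp [hB, mulVec_diagonal]
  have hBs (u : Fin (n + 1) → R) (i : Fin (n + 1)) (hi : i ≠ 0) : (B *ᵥ u) i = u i := by
    simp [hB, mulVec_diagonal, hi]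
  obtain ⟨X, hX⟩ : ∃ X, a • (1 : Matrix (Fin (n + 1)) (Fin (n + 1)) R) = B * E + α * X :=
    ⟨adjugate α * Y, by rw [← hY, ← mul_assoc, mul_adjugate, smul_mul_assoc, one_mul]⟩
  obtain ⟨c, e, hce⟩ := id h
  obtain ⟨w, u, hwu⟩ := h.pow_left (m := n + 1)
  let f : Fin (n + 2) → R := Fin.snoc (α := fun _ => R) (α 0) (a ^ (n + 1))
  let g : Fin (n + 2) → R := Fin.snoc (α := fun _ => R) (fun j => u * adjugate α j 0) w
  have hfg : f ⬝ᵥ g = 1 := by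
    have := congrFun₂ (mul_adjugate α) 0 0
    rw [Matrix.mul_apply] at this
    simp only [Matrix.smul_apply, one_apply_eq, smul_eq_mul, mul_one] at this
    rw [dotProduct, Fin.sum_univ_castSucc]
    simp only [f, g, Fin.snoc_castSucc, Fin.snoc_last]
    rw [← hwu, ← this, Finset.mul_sum, add_comm, mul_comm w]
    congr 1
    exact Finset.sum_congr rfl fun _ _ => by ring
  have hker (x : Fin (n + 1) → R) (y : R) : f ⬝ᵥ (Fin.snoc (α := fun _ => R) x y) =
      (α *ᵥ x) 0 + a ^ (n + 1) * y := by
    simp [f, dotProduct, Fin.sum_univ_castSucc, mulVec]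
  let N : Matrix (Fin (n + 2)) (Fin (n + 1)) R :=
    Fin.snoc (α := fun _ => Fin (n + 1) → R) (a • (1 : Matrix _ _ R) - X * α) ((-(E * α)) 0)
  have hN (t : Fin (n + 1) → R) : N *ᵥ t =
      Fin.snoc (α := fun _ => R) (a • t - (X * α) *ᵥ t) (-((E * α) *ᵥ t) 0) := by
    ext i
    refine Fin.lastCases ?_ (fun i => ?_) i
    · simp [N, mulVec, dotProduct]
    · have : a • t = (a • (1 : Matrix (Fin (n + 1)) (Fin (n + 1)) R)) *ᵥ t := by
        simp [smul_mulVec]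
      rw [Fin.snoc_castSucc, this, ← sub_mulVec]
      simp only [N, mulVec, Fin.snoc_castSucc]
      rfl
  have hX' (t : Fin (n + 1) → R) : a • t = B *ᵥ (E *ᵥ t) + α *ᵥ (X *ᵥ t) := by
    rw [mulVec_mulVec, mulVec_mulVec, ← add_mulVec, ← hX, smul_mulVec, one_mulVec]
  have hfN (t : Fin (n + 1) → R) : f ⬝ᵥ (N *ᵥ t) = 0 := by
    rw [hN, hker, mulVec_sub, mulVec_smul, hX', ← mulVec_mulVec, ← mulVec_mulVec, mul_neg,
      ← hB0, add_sub_cancel_right, add_neg_cancel]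
  let Q : Matrix (Fin (n + 2)) (Fin (n + 2)) R :=
    of fun i => Fin.cons (α := fun _ => R) (g i) (N i)
  have hQ (s : Fin (n + 2) → R) : Q *ᵥ s = s 0 • g + N *ᵥ (Fin.tail s) := by
    ext i
    simp [Q, mulVec, dotProduct, Fin.sum_univ_succ, Fin.tail, mul_comm]
  have hsurj : Function.Surjective Q.mulVec := by
    intro z
    obtain ⟨t, ht⟩ : ∃ t, N *ᵥ t = z - (f ⬝ᵥ z) • g := by
      have hz0 : f ⬝ᵥ (z - (f ⬝ᵥ z) • g) = 0 := by
        rw [dotProduct_sub, dotProduct_smul, hfg]; simp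
      generalize z - (f ⬝ᵥ z) • g = z at hz0
      obtain ⟨x, y, rfl⟩ : ∃ x y, z = Fin.snoc (α := fun _ => R) x y :=
        ⟨Fin.init z, z (Fin.last _), (Fin.snoc_init_self z).symm⟩
      rw [hker] at hz0
      let v : Fin (n + 1) → R := fun i => if i = 0 then y else -(α *ᵥ x) i
      have hv : α *ᵥ x + B *ᵥ v = 0 := by
        ext i
        by_cases hi : i = 0
        · subst hi; simp [hB0, v, hz0]
        · simp [hBs, hi, v]
      let y' := E' *ᵥ v
      have hEy : E *ᵥ y' = v := by simp [y', mulVec_mulVec, hE]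
      let x' := x - X *ᵥ y'
      have hx' : α *ᵥ x' = - (a • y') := by
        rw [hX', hEy, mulVec_sub, eq_neg_iff_add_eq_zero, ← hv]; abel
      let t := c • x' - (e • adjugate α) *ᵥ y'
      have hαt : α *ᵥ t = - y' := by
        have : α *ᵥ t = - ((c * a + e * α.det) • y') := by
          simp only [t, mulVec_sub, mulVec_smul, smul_mulVec, mulVec_mulVec, mul_adjugate, hx',
            one_mulVec, add_smul, mul_smul, smul_neg]
          abel
        rw [this, hce, one_smul]
      have hat : a • t = x' := by
        have : a • t = (c * a + e * α.det) • x' := by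
          have h2 : α.det • x' = - (a • (adjugate α *ᵥ y')) := by
            rw [← mulVec_smul, ← mulVec_neg, ← hx', mulVec_mulVec, adjugate_mul, smul_mulVec,
              one_mulVec]
          rw [add_smul, mul_smul e, h2]
          simp only [t, smul_sub, smul_mulVec, smul_neg, mul_smul, smul_comm a]
          abel
        rw [this, hce, one_smul]
      refine ⟨t, ?_⟩
      rw [hN, ← mulVec_mulVec, ← mulVec_mulVec, hαt, hat, mulVec_neg, mulVec_neg, hEy]
      simp [x', v]
    refine ⟨Fin.cons (α := fun _ => R) (f ⬝ᵥ z) t, ?_⟩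
    rw [hQ, Fin.cons_zero, Fin.tail_cons, ht]
    abel
  obtain ⟨M, hM⟩ := mulVec_surjective_iff_exists_right_inverse.mp hsurj
  refine ⟨Q, M, hM, ?_⟩
  have hfQ : f ᵥ* Q = Pi.single 0 1 := by
    refine dotProduct_eq _ _ fun s => ?_
    rw [← dotProduct_mulVec, hQ, dotProduct_add, hfN, dotProduct_smul, hfg]
    simp
  calc M 0 = Pi.single 0 1 ᵥ* M := by simp [Matrix.row]
    _ = f := by rw [← hfQ, vecMul_vecMul, hM, vecMul_one]

/-- Suslin's theorem on completable unimodular rows. -/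
theorem exists_completion_of_unimodular {R : Type*} [CommRing R] {n : ℕ} (b g : Fin (n + 1) → R)
    (hbg : ∑ i, b i * g i = 1) :
    ∃ Q M : Matrix (Fin (n + 1)) (Fin (n + 1)) R, Q * M = 1 ∧
      ∀ i, M 0 i = b i ^ max 1 (i : ℕ) := by
  induction n generalizing R with
  | zero =>
    refine ⟨of fun _ _ => g 0, of fun _ _ => b 0, ?_, ?_⟩
    · ext i j
      fin_cases i; fin_cases j
      simpa [Matrix.mul_apply, mul_comm] using hbg
    · intro i; fin_cases i; simp
  | succ n ih =>
    let a := b (Fin.last _)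
    let π := Ideal.Quotient.mk (Ideal.span {a})
    have hπa : π a = 0 := Ideal.Quotient.eq_zero_iff_mem.mpr (Ideal.mem_span_singleton_self a)
    obtain ⟨Q, M, hQM, hM⟩ := ih (fun i => π (b i.castSucc)) (fun i => π (g i.castSucc)) (by
      have := congrArg π hbg
      rw [Fin.sum_univ_castSucc, map_add, map_mul, hπa, zero_mul, add_zero, map_sum, map_one]
        at this
      simpa using this)
    have hsurj : Function.Surjective π := Ideal.Quotient.mk_surjective
    let α : Matrix (Fin (n + 1)) (Fin (n + 1)) R := of fun i j =>
      if i = 0 then b j.castSucc ^ max 1 (j : ℕ) else Function.surjInv hsurj (M i j)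
    have hα : π.mapMatrix α = M := by
      ext i j
      by_cases hi : i = 0
      · subst hi; simp [α, hM]
      · simp [α, hi, Function.surjInv_eq hsurj]
    have hcop : IsCoprime a α.det := by
      obtain ⟨u, hu⟩ := hsurj Q.det
      have : π (u * α.det) = 1 := by
        rw [map_mul, hu, RingHom.map_det, hα, ← det_mul, hQM, det_one]
      rw [← map_one π, Ideal.Quotient.mk_eq_mk_iff_sub_mem, Ideal.mem_span_singleton] at this
      obtain ⟨c, hc⟩ := this
      exact ⟨-c, u, by linear_combination hc⟩
    obtain ⟨Q', M', hQM', hM'⟩ := exists_completion_snoc_pow α hcop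
    refine ⟨Q', M', hQM', fun i => ?_⟩
    rw [hM']
    refine Fin.lastCases ?_ (fun i => ?_) i
    · simp [a]
    · simp [α]

end Completion

theorem commutator_mem_center_of_card_eq_prime_cube {p : ℕ} [Fact p.Prime] {P : Type*} [Group P]
    [Finite P] (hcard : Nat.card P = p ^ 3) (a b : P) :
    a * b * a⁻¹ * b⁻¹ ∈ Subgroup.center P := by
  have hp : p.Prime := Fact.out
  have hP : IsPGroup p P := IsPGroup.of_card hcard
  have : Nontrivial P := by
    rw [← Finite.one_lt_card_iff_nontrivial, hcard]
    exact Nat.one_lt_pow (by norm_num) hp.one_lt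
  have hZ : Nontrivial (Subgroup.center P) := hP.center_nontrivial
  obtain ⟨m, hm⟩ := IsPGroup.iff_card.mp (hP.to_subgroup (Subgroup.center P))
  obtain ⟨l, hl⟩ := IsPGroup.iff_card.mp (hP.to_quotient (Subgroup.center P))
  have hml : l + m = 3 := by
    have := Subgroup.card_eq_card_quotient_mul_card_subgroup (Subgroup.center P)
    rw [hcard, hl, hm, ← pow_add] at this
    exact (Nat.pow_right_injective hp.two_le this).symm
  have hm0 : m ≠ 0 := by
    rintro rfl
    have := Finite.one_lt_card_iff_nontrivial.mpr hZ
    simp [hm] at this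
  have hcomm : ∀ x y : P ⧸ Subgroup.center P, x * y = y * x := by
    obtain rfl | rfl | rfl : l = 0 ∨ l = 1 ∨ l = 2 := by omega
    · have : Subsingleton (P ⧸ Subgroup.center P) :=
        (Nat.card_eq_one_iff_unique.mp (by simpa using hl)).1
      exact fun x y => Subsingleton.elim _ _
    · have := isCyclic_of_prime_card (α := P ⧸ Subgroup.center P) (by simpa using hl)
      exact fun x y => (IsCyclic.isMulCommutative).is_comm.comm x y
    · exact fun x y => (IsPGroup.isMulCommutative_of_card_eq_prime_sq hl).is_comm.comm x y
  rw [← QuotientGroup.eq_one_iff]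
  have := hcomm a b
  rw [QuotientGroup.mk_mul, QuotientGroup.mk_mul, QuotientGroup.mk_mul, this,
    QuotientGroup.mk_inv, QuotientGroup.mk_inv]
  group

/-- A nonabelian group of order `p ^ 3` and exponent `p` has coordinates with values in `ZMod p` in
which the multiplication is that of the Heisenberg group. -/
theorem exists_heisenberg_coordinates {p : ℕ} [Fact p.Prime] {P : Type*} [Group P]
    [Finite P] (hcard : Nat.card P = p ^ 3) (hnonab : ¬ ∀ a b : P, a * b = b * a)
    (hexp : ∀ g : P, g ^ p = 1) :
    ∃ x y z : P → ZMod p, (∀ g h, x (g * h) = x g + x h) ∧ (∀ g h, y (g * h) = y g + y h) ∧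
      (∀ g h, z (g * h) = z g + z h + x g * y h) ∧
      ∀ g, x g = 0 → y g = 0 → z g = 0 → g = 1 := by
  have hp : p.Prime := Fact.out
  push Not at hnonab
  obtain ⟨a, b, hab⟩ := hnonab
  obtain ⟨c, hc⟩ : ∃ c, c = a * b * a⁻¹ * b⁻¹ := ⟨_, rfl⟩
  have hcen : ∀ g, Commute c g := fun g =>
    ((Subgroup.mem_center_iff.mp
      (hc ▸ commutator_mem_center_of_card_eq_prime_cube hcard a b)) g).symm
  have hc1 : c ≠ 1 := by
    rintro rfl
    apply hab
    rw [eq_comm, mul_inv_eq_one, mul_inv_eq_iff_eq_mul] at hc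
    exact hc
  have habc : a * b = c * (b * a) := by rw [hc]; group
  let pw (g : P) (t : ZMod p) : P := g ^ t.val
  have pw_add (g : P) (s t : ZMod p) : pw g (s + t) = pw g s * pw g t := by
    simp only [pw]
    rw [ZMod.val_add, ← pow_add, pow_eq_pow_mod (s.val + t.val) (hexp g)]
  have pw_cen (t : ZMod p) (g : P) : Commute (pw c t) g := (hcen g).pow_left _
  have pw_inj : Function.Injective (pw c) := by
    have hord : orderOf c = p := orderOf_eq_prime (hexp c) hc1
    intro s t hst
    have := pow_injOn_Iio_orderOf (by simpa [hord] using s.val_lt) (by simpa [hord] using t.val_lt)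
      hst
    exact ZMod.val_injective p this
  have pow_ab (m k : ℕ) : a ^ m * b ^ k = c ^ (m * k) * (b ^ k * a ^ m) := by
    have h1 (m : ℕ) : a ^ m * b = c ^ m * (b * a ^ m) := by
      induction m with
      | zero => simp
      | succ m ih =>
        rw [pow_succ, mul_assoc, habc, ← mul_assoc, ← ((hcen (a ^ m)).eq), mul_assoc,
          ← mul_assoc _ b, ih]
        simp only [pow_succ, mul_assoc]
        rw [← mul_assoc c, (hcen _).eq]
        simp only [mul_assoc]
    induction k with
    | zero => simp
    | succ k ih =>
      rw [pow_succ, ← mul_assoc, ih, mul_assoc, mul_assoc, h1, ← mul_assoc (b ^ k),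
        ← ((hcen (b ^ k)).pow_left m).eq, Nat.mul_succ, pow_add]
      simp only [mul_assoc]
  have pw_ab (s t : ZMod p) : pw a s * pw b t = pw c (s * t) * (pw b t * pw a s) := by
    simp only [pw]
    rw [pow_ab, ZMod.val_mul, ← pow_eq_pow_mod _ (hexp c)]
  let θ (w : ZMod p × ZMod p × ZMod p) : P := pw c w.2.2 * (pw b w.2.1 * pw a w.1)
  have θ_mul (v w : ZMod p × ZMod p × ZMod p) :
      θ v * θ w = θ (v.1 + w.1, v.2.1 + w.2.1, v.2.2 + w.2.2 + v.1 * w.2.1) := by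
    simp only [θ, pw_add]
    calc _ = pw c v.2.2 * (pw b v.2.1 * (pw a v.1 * pw c w.2.2) * pw b w.2.1 * pw a w.1) := by
          simp only [mul_assoc]
      _ = pw c v.2.2 * ((pw b v.2.1 * pw c w.2.2) * (pw a v.1 * pw b w.2.1) * pw a w.1) := by
          rw [← (pw_cen w.2.2 (pw a v.1)).eq]; simp only [mul_assoc]
      _ = pw c v.2.2 * pw c w.2.2 * ((pw b v.2.1 * pw c (v.1 * w.2.1)) *
            (pw b w.2.1 * pw a v.1) * pw a w.1) := by
          rw [pw_ab, ← (pw_cen w.2.2 _).eq]; simp only [mul_assoc]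
      _ = _ := by rw [← (pw_cen (v.1 * w.2.1) _).eq]; simp only [mul_assoc]
  have θ_inj : Function.Injective θ := by
    have pw0 (g : P) : pw g 0 = 1 := by simp [pw]
    rintro ⟨x, y, z⟩ ⟨x', y', z'⟩ h
    have key (w : ZMod p × ZMod p × ZMod p) :
        θ w * θ (0, 1, 0) = pw c w.1 * (θ (0, 1, 0) * θ w) ∧
        θ (1, 0, 0) * θ w = pw c w.2.1 * (θ w * θ (1, 0, 0)) := by
      constructor <;> rw [θ_mul, θ_mul] <;> simp only [θ, ← mul_assoc, ← pw_add] <;> ring_nf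
    have hx : x = x' := pw_inj (by
      have h1 := (key (x, y, z)).1
      rw [h, (key (x', y', z')).1] at h1
      exact (mul_right_cancel h1).symm)
    have hy : y = y' := pw_inj (by
      have h1 := (key (x, y, z)).2
      rw [h, (key (x', y', z')).2] at h1
      exact (mul_right_cancel h1).symm)
    subst hx hy
    have hz : z = z' := pw_inj (mul_right_cancel h)
    rw [hz]
  have θ_bij : Function.Bijective θ := by
    refine (Nat.bijective_iff_injective_and_card θ).mpr ⟨θ_inj, ?_⟩
    rw [hcard, Nat.card_prod, Nat.card_prod, Nat.card_zmod]; ring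
  let e := Equiv.ofBijective θ θ_bij
  have he (g h : P) : e.symm (g * h) = ((e.symm g).1 + (e.symm h).1,
      (e.symm g).2.1 + (e.symm h).2.1,
      (e.symm g).2.2 + (e.symm h).2.2 + (e.symm g).1 * (e.symm h).2.1) := by
    rw [Equiv.symm_apply_eq]
    change _ = θ _
    rw [← θ_mul]
    change _ = e _ * e _
    simp
  refine ⟨fun g => (e.symm g).1, fun g => (e.symm g).2.1, fun g => (e.symm g).2.2,
    fun g h => by simp only [he], fun g h => by simp only [he], fun g h => by simp only [he],
    fun g hx hy hz => ?_⟩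
  have : e.symm g = (0, 0, 0) := Prod.ext hx (Prod.ext hy hz)
  rw [Equiv.symm_apply_eq] at this
  rw [this]
  change θ _ = 1
  simp [θ, pw]

open Matrix in
/-- The complex vector bundle over the unit sphere of `ℂ^ι` whose fibre at `v` consists of the
`w` with `∑ t, v t ^ k * w t = 0` is trivial when `k` is divisible by every positive integer
less than the cardinality of `ι`. -/
theorem exists_trivialization_ker_pow {ι : Type*} [Fintype ι] {n k : ℕ}
    (hι : Fintype.card ι = n + 1) (hk0 : k ≠ 0) (hk : ∀ i, 0 < i → i ≤ n → i ∣ k) :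
    ∃ (F : sphere (0 : EuclideanSpace ℂ ι) 1 → EuclideanSpace ℂ (Fin n) →ₗ[ℂ] EuclideanSpace ℂ ι)
      (G : sphere (0 : EuclideanSpace ℂ ι) 1 → EuclideanSpace ℂ ι →ₗ[ℂ] EuclideanSpace ℂ (Fin n)),
      Continuous (fun q : _ × _ => F q.1 q.2) ∧ Continuous (fun q : _ × _ => G q.1 q.2) ∧
      (∀ v u, G v (F v u) = u) ∧ (∀ v u, ∑ t, v.1 t ^ k * F v u t = 0) ∧
      ∀ v w, ∑ t, v.1 t ^ k * w t = 0 → F v (G v w) = w := by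
  let S := sphere (0 : EuclideanSpace ℂ ι) 1
  obtain ⟨e⟩ : Nonempty (Fin (n + 1) ≃ ι) := ⟨(Fintype.equivFinOfCardEq hι).symm⟩
  have hdvd (i : Fin (n + 1)) : max 1 (i : ℕ) ∣ k := by
    by_cases hi : (i : ℕ) = 0
    · simp [hi]
    · rw [max_eq_right (by omega)]; exact hk _ (by omega) (by omega)
  have hdiv (i : Fin (n + 1)) : k / max 1 (i : ℕ) ≠ 0 := fun h => by
    have := Nat.div_mul_cancel (hdvd i)
    rw [h, zero_mul] at this
    exact hk0 this.symm
  let b (i : Fin (n + 1)) : C(S, ℂ) :=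
    ⟨fun v => v.1 (e i) ^ (k / max 1 (i : ℕ)), by fun_prop⟩
  let N : C(S, ℂ) := ∑ i, b i * star (b i)
  have hN (v : S) : N v ≠ 0 := by
    have h1 : N v = ((∑ i, ‖b i v‖ ^ 2 : ℝ) : ℂ) := by
      simp [N, ContinuousMap.sum_apply, RCLike.mul_conj]
    rw [h1, Complex.ofReal_ne_zero]
    intro h
    rw [Finset.sum_eq_zero_iff_of_nonneg fun _ _ => by positivity] at h
    apply ne_zero_of_mem_unit_sphere v
    ext t
    have := h (e.symm t) (Finset.mem_univ _)
    simpa [b, hdiv] using this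
  let N' : C(S, ℂ) := ⟨fun v => (N v)⁻¹, N.continuous.inv₀ hN⟩
  obtain ⟨Q, M, hQM, hM⟩ := exists_completion_of_unimodular b (fun i => star (b i) * N') (by
    have : N * N' = 1 := by
      ext v
      exact mul_inv_cancel₀ (hN v)
    rw [← this, Finset.sum_mul]
    simp only [mul_assoc])
  let Qv (v : S) : Matrix (Fin (n + 1)) (Fin (n + 1)) ℂ := of fun i j => Q i j v
  let Mv (v : S) : Matrix (Fin (n + 1)) (Fin (n + 1)) ℂ := of fun i j => M i j v
  have hQMv (v : S) : Qv v * Mv v = 1 := by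
    ext i j
    have := congrArg (fun f : C(S, ℂ) => f v) (congrFun₂ hQM i j)
    simp only [Matrix.mul_apply, ContinuousMap.sum_apply, ContinuousMap.mul_apply] at this
    simp only [Matrix.mul_apply, Qv, Mv, of_apply, this, Matrix.one_apply]
    split_ifs <;> rfl
  have hMQv (v : S) : Mv v * Qv v = 1 := mul_eq_one_comm.mp (hQMv v)
  have hM0 (v : S) (w : ι → ℂ) : (Mv v *ᵥ (w ∘ e)) 0 = ∑ t, v.1 t ^ k * w t := by
    rw [← e.sum_comp]
    simp only [mulVec, dotProduct, Mv, of_apply, hM, b, ContinuousMap.pow_apply,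
      ContinuousMap.coe_mk, ← pow_mul, Nat.div_mul_cancel (hdvd _), Function.comp_apply]
  let F (v : S) : EuclideanSpace ℂ (Fin n) →ₗ[ℂ] EuclideanSpace ℂ ι :=
    { toFun u := WithLp.toLp 2 fun t => (Qv v *ᵥ Fin.cons (α := fun _ => ℂ) 0 u) (e.symm t)
      map_add' u u' := by
        ext t
        simp [mulVec, dotProduct, Fin.sum_univ_succ, mul_add, Finset.sum_add_distrib]
      map_smul' c u := by
        ext t
        simp [mulVec, dotProduct, Fin.sum_univ_succ, Finset.mul_sum, mul_left_comm] }
  let G (v : S) : EuclideanSpace ℂ ι →ₗ[ℂ] EuclideanSpace ℂ (Fin n) :=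
    { toFun w := WithLp.toLp 2 (Fin.tail (Mv v *ᵥ (w ∘ e)))
      map_add' u u' := by
        ext t
        simp [mulVec, dotProduct, Fin.tail, mul_add, Finset.sum_add_distrib]
      map_smul' c u := by
        ext t
        simp [mulVec, dotProduct, Fin.tail, Finset.mul_sum, mul_left_comm] }
  have hF (v : S) (u : EuclideanSpace ℂ (Fin n)) :
      Mv v *ᵥ (F v u ∘ e) = Fin.cons (α := fun _ => ℂ) 0 u := by
    have : F v u ∘ e = Qv v *ᵥ Fin.cons (α := fun _ => ℂ) 0 u := by
      ext i; simp [F]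
    rw [this, mulVec_mulVec, hMQv, one_mulVec]
  refine ⟨F, G, ?_, ?_, fun v u => ?_, fun v u => ?_, fun v w hw => ?_⟩
  · refine (PiLp.continuous_toLp 2 _).comp (continuous_pi fun t => ?_)
    simp only [mulVec, dotProduct, Fin.sum_univ_succ, Fin.cons_zero, Fin.cons_succ, mul_zero,
      zero_add, Qv, of_apply]
    fun_prop
  · refine (PiLp.continuous_toLp 2 _).comp (continuous_pi fun t => ?_)
    simp only [mulVec, dotProduct, Fin.tail, Mv, of_apply, Function.comp_apply]
    fun_prop
  · change WithLp.toLp 2 (Fin.tail (Mv v *ᵥ (F v u ∘ e))) = u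
    rw [hF, Fin.tail_cons]
  · rw [← hM0, hF, Fin.cons_zero]
  · rw [← hM0] at hw
    have h1 : Fin.cons (α := fun _ => ℂ) 0 (G v w) = Mv v *ᵥ (w ∘ e) := by
      rw [← hw]
      exact Fin.cons_self_tail _
    ext t
    change (Qv v *ᵥ Fin.cons (α := fun _ => ℂ) 0 (G v w)) (e.symm t) = w t
    rw [h1, mulVec_mulVec, hQMv, one_mulVec]
    simp

theorem inv_norm_smul_ofReal_smul {E : Type*} [NormedAddCommGroup E] [NormedSpace ℂ E] {u : E}
    (hu : ‖u‖ = 1) {r : ℝ} (hr : 0 < r) : ((‖(r : ℂ) • u‖ : ℂ)⁻¹) • ((r : ℂ) • u) = u := by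
  have : (r : ℂ) ≠ 0 := by exact_mod_cast hr.ne'
  rw [norm_smul, hu, mul_one, Complex.norm_real, Real.norm_of_nonneg hr.le, inv_smul_smul₀ this]

/-- A trivialization of a family of subspaces trivializes the associated sphere bundle. -/
theorem nonempty_homeomorph_sphere_bundle {S E₁ E₂ : Type*} [TopologicalSpace S]
    [NormedAddCommGroup E₁] [NormedSpace ℂ E₁] [NormedAddCommGroup E₂] [NormedSpace ℂ E₂]
    (K : S → Submodule ℂ E₁) (F : S → E₂ →ₗ[ℂ] E₁) (G : S → E₁ →ₗ[ℂ] E₂)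
    (hF : Continuous (fun q : S × E₂ => F q.1 q.2))
    (hG : Continuous (fun q : S × E₁ => G q.1 q.2))
    (hGF : ∀ v u, G v (F v u) = u) (hFK : ∀ v u, F v u ∈ K v)
    (hFG : ∀ v, ∀ w ∈ K v, F v (G v w) = w) :
    Nonempty ((S × sphere (0 : E₂) 1) ≃ₜ {q : S × sphere (0 : E₁) 1 // (q.2 : E₁) ∈ K q.1}) := by
  have hF0 (v : S) (u : sphere (0 : E₂) 1) : F v u ≠ 0 := fun h => by
    have := hGF v u
    rw [h, map_zero] at this
    exact ne_zero_of_mem_unit_sphere u this.symm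
  have hG0 (q : {q : S × sphere (0 : E₁) 1 // (q.2 : E₁) ∈ K q.1}) : G q.1.1 q.1.2 ≠ 0 :=
      fun h => by
    have := hFG q.1.1 q.1.2 q.2
    rw [h, map_zero] at this
    exact ne_zero_of_mem_unit_sphere q.1.2 this.symm
  refine ⟨
    { toFun q := ⟨(q.1, ⟨(‖F q.1 q.2‖ : ℂ)⁻¹ • F q.1 q.2, ?_⟩), (K q.1).smul_mem _ (hFK _ _)⟩
      invFun q := (q.1.1, ⟨(‖G q.1.1 q.1.2‖ : ℂ)⁻¹ • G q.1.1 q.1.2, ?_⟩)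
      left_inv := ?_
      right_inv := ?_
      continuous_toFun := ?_
      continuous_invFun := ?_ }⟩
  · rw [mem_sphere_zero_iff_norm]; exact norm_smul_inv_norm (hF0 _ _)
  · rw [mem_sphere_zero_iff_norm]; exact norm_smul_inv_norm (hG0 _)
  · rintro ⟨v, u⟩
    refine Prod.ext rfl (Subtype.ext ?_)
    simp only [map_smul, hGF]
    have := inv_norm_smul_ofReal_smul (norm_eq_of_mem_sphere u)
      (inv_pos.mpr (norm_pos_iff.mpr (hF0 v u)))
    rwa [Complex.ofReal_inv] at this
  · intro q
    refine Subtype.ext (Prod.ext rfl (Subtype.ext ?_))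
    simp only [map_smul, hFG _ _ q.2]
    have := inv_norm_smul_ofReal_smul (norm_eq_of_mem_sphere q.1.2)
      (inv_pos.mpr (norm_pos_iff.mpr (hG0 q)))
    rwa [Complex.ofReal_inv] at this
  · have h : Continuous fun q : S × sphere (0 : E₂) 1 => F q.1 q.2 :=
      hF.comp (continuous_fst.prodMk (continuous_subtype_val.comp continuous_snd))
    refine Continuous.subtype_mk (continuous_fst.prodMk (Continuous.subtype_mk ?_ _)) _
    exact ((Complex.continuous_ofReal.comp h.norm).inv₀
      fun q => by simpa using hF0 q.1 q.2).smul h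
  · have h : Continuous fun q : {q : S × sphere (0 : E₁) 1 // (q.2 : E₁) ∈ K q.1} =>
        G q.1.1 q.1.2 := hG.comp ((continuous_fst.comp continuous_subtype_val).prodMk
          (continuous_subtype_val.comp (continuous_snd.comp continuous_subtype_val)))
    refine (by fun_prop : Continuous fun q : {q : S × sphere (0 : E₁) 1 // (q.2 : E₁) ∈ K q.1} =>
      q.1.1).prodMk (Continuous.subtype_mk ?_ _)
    exact ((Complex.continuous_ofReal.comp h.norm).inv₀ fun q => by simpa using hG0 q).smul h

theorem nonempty_homeomorph_sph {ι : Type*} [Fintype ι] {m : ℕ} (h : 2 * Fintype.card ι = m + 1) :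
    Nonempty (Sph m ≃ₜ sphere (0 : EuclideanSpace ℂ ι) 1) := by
  have hrank : Module.finrank ℝ (EuclideanSpace ℂ ι) = m + 1 := by
    rw [finrank_real_of_complex, finrank_euclideanSpace, h]
  let e : EuclideanSpace ℂ ι ≃ₗᵢ[ℝ] EuclideanSpace ℝ (Fin (m + 1)) :=
    ((stdOrthonormalBasis ℝ (EuclideanSpace ℂ ι)).reindex (finCongr hrank)).repr
  exact ⟨e.symm.toHomeomorph.subtype fun x => by simp⟩

theorem exists_free_hom_of_homeomorph {P X Y : Type*} [Group P] [TopologicalSpace X]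
    [TopologicalSpace Y] (e : X ≃ₜ Y) (act : P → Y → Y) (hc : ∀ g, Continuous (act g))
    (h1 : ∀ y, act 1 y = y) (hmul : ∀ g h y, act (g * h) y = act g (act h y))
    (hfree : ∀ g y, act g y = y → g = 1) :
    ∃ φ : P →* (X ≃ₜ X), ∀ g x, φ g x = x → g = 1 := by
  refine ⟨MonoidHom.mk' (fun g =>
    { toFun x := e.symm (act g (e x))
      invFun x := e.symm (act g⁻¹ (e x))
      left_inv x := by simp [← hmul, h1]
      right_inv x := by simp [← hmul, h1]
      continuous_toFun := e.symm.continuous.comp ((hc _).comp e.continuous)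
      continuous_invFun := e.symm.continuous.comp ((hc _).comp e.continuous) })
    fun g h => Homeomorph.ext fun x => ?_, fun g x hx => hfree g (e x) ?_⟩
  · change e.symm (act (g * h) (e x)) = e.symm (act g (e (e.symm (act h (e x)))))
    rw [e.apply_symm_apply, hmul]
  · exact e.symm_apply_eq.mp hx

theorem eq_of_periodic_zmod {p : ℕ} [Fact p.Prime] {α : Type*} {f : ZMod p → α} {x : ZMod p}
    (hx : x ≠ 0) (hf : ∀ t, f (t + x) = f t) (s t : ZMod p) : f s = f t := by
  have key (s : ZMod p) : f s = f 0 := by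
    have h (m : ℕ) : f (m * x) = f 0 := by
      induction m with
      | zero => simp
      | succ m ih => rw [← ih, ← hf (m * x)]; congr 1; push_cast; ring
    rw [← h (s / x).val, ZMod.natCast_zmod_val, div_mul_cancel₀ s hx]
  rw [key s, key t]

theorem heisenberg_stabilizer_trivial {p k : ℕ} [Fact p.Prime] (hk : (k : ZMod p) + 1 = 0)
    {x y z : ZMod p} {v w : ZMod p → ℂ} (hv0 : v ≠ 0) (hw0 : w ≠ 0)
    (hv : ∀ t, ZMod.stdAddChar (z + y * t) * v (t + x) = v t)
    (hw : ∀ t, ZMod.stdAddChar (z + y * t) * w (t + x) = w t)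
    (hvw : ∑ t, v t ^ k * w t = 0) : x = 0 ∧ y = 0 ∧ z = 0 := by
  have hψ (s : ZMod p) : (ZMod.stdAddChar s : ℂ) ^ (k + 1) = 1 := by
    rw [← AddChar.map_nsmul_eq_pow, nsmul_eq_mul]; push_cast; simp [hk]
  have hψ0 (s : ZMod p) : (ZMod.stdAddChar s : ℂ) ≠ 0 := fun h => by simpa [h] using hψ s
  obtain ⟨t₀, ht₀⟩ := Function.ne_iff.mp hv0
  obtain ⟨t₁, ht₁⟩ := Function.ne_iff.mp hw0
  by_cases hx : x = 0
  · subst hx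
    have key {u : ZMod p → ℂ} (hu : ∀ t, ZMod.stdAddChar (z + y * t) * u (t + 0) = u t)
        (t : ZMod p) (ht : u t ≠ 0) : z + y * t = 0 := by
      have := hu t
      rw [add_zero, mul_eq_right₀ ht] at this
      exact ZMod.injective_stdAddChar (by rw [this, AddChar.map_zero_eq_one])
    by_cases hy : y = 0
    · subst hy
      exact ⟨rfl, rfl, by simpa using key hv t₀ ht₀⟩
    · have huniq {u : ZMod p → ℂ} (hu : ∀ t, ZMod.stdAddChar (z + y * t) * u (t + 0) = u t)
          (t : ZMod p) (ht : u t ≠ 0) : t = t₀ :=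
        mul_left_cancel₀ hy (by linear_combination key hu t ht - key hv t₀ ht₀)
      obtain rfl := huniq hw t₁ ht₁
      rw [Finset.sum_eq_single t₁ (fun t _ ht => by
        rw [not_not.mp (mt (huniq hw t) ht), mul_zero]) (by simp)] at hvw
      exact absurd hvw (mul_ne_zero (pow_ne_zero _ ht₀) ht₁)
  · exfalso
    have hc (t : ZMod p) : v (t + x) ^ k * w (t + x) = v t ^ k * w t := by
      rw [← hv t, ← hw t, mul_pow]
      linear_combination -(v (t + x) ^ k * w (t + x)) * hψ (z + y * t)
    have hne {u : ZMod p → ℂ} (hu : ∀ t, ZMod.stdAddChar (z + y * t) * u (t + x) = u t)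
        (t : ZMod p) :
        (u (t + x) = 0) = (u t = 0) := by
      rw [← hu t]; simp [hψ0]
    have hv' : v 0 ≠ 0 := fun h =>
      ht₀ ((eq_of_periodic_zmod (f := fun t => v t = 0) hx (hne hv) t₀ 0).mpr h)
    have hw' : w 0 ≠ 0 := fun h =>
      ht₁ ((eq_of_periodic_zmod (f := fun t => w t = 0) hx (hne hw) t₁ 0).mpr h)
    rw [Finset.sum_congr rfl fun t _ =>
      eq_of_periodic_zmod (f := fun t => v t ^ k * w t) hx hc t 0] at hvw
    simp [hv', hw', (Fact.out : p.Prime).ne_zero] at hvw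

/-- **Example (extraspecial groups).** For an odd prime `p`, the extraspecial group of
order `p³` and exponent `p` — i.e. any nonabelian group of order `p³` all of whose elements
satisfy `g^p = 1` — acts freely (by homeomorphisms) on `S^{2p-1} × S^{2p-3}`. -/
theorem extraspecial_p_cubed_exponent_p_acts_freely_on_product_of_two_spheres
    (p : ℕ) (hp : p.Prime) (hodd : Odd p)
    (P : Type) [Group P] [Finite P]
    (hcard : Nat.card P = p ^ 3)
    (hnonab : ¬ ∀ a b : P, a * b = b * a)
    (hexp : ∀ g : P, g ^ p = 1) :
    ∃ φ : P →* ((Sph (2 * p - 1) × Sph (2 * p - 3)) ≃ₜ (Sph (2 * p - 1) × Sph (2 * p - 3))),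
      ∀ (g : P) (x : Sph (2 * p - 1) × Sph (2 * p - 3)), φ g x = x → g = 1 := by
  have : Fact p.Prime := ⟨hp⟩
  have hp2 := hp.two_le
  obtain ⟨x, y, z, hx, hy, hz, hxyz⟩ := exists_heisenberg_coordinates hcard hnonab hexp
  obtain ⟨k, hk⟩ : ∃ k, k = (p - 1).factorial := ⟨_, rfl⟩
  have hk1 : (k : ZMod p) + 1 = 0 := by rw [hk, ZMod.wilsons_lemma]; simp
  obtain ⟨F, G, hF, hG, hGF, hFK, hFG⟩ :=
    exists_trivialization_ker_pow (ι := ZMod p) (n := p - 1) (k := k) (by rw [ZMod.card]; omega)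
      (hk ▸ Nat.factorial_ne_zero _) (fun i hi hin => hk ▸ Nat.dvd_factorial hi hin)
  let K (v : sphere (0 : EuclideanSpace ℂ (ZMod p)) 1) : Submodule ℂ (EuclideanSpace ℂ (ZMod p)) :=
    { carrier := {w | ∑ t, v.1 t ^ k * w t = 0}
      add_mem' {a b} ha hb := by
        rw [Set.mem_ofPred_eq] at ha hb ⊢
        simp [mul_add, Finset.sum_add_distrib, ha, hb]
      zero_mem' := by simp
      smul_mem' c a ha := by
        rw [Set.mem_ofPred_eq] at ha ⊢
        simp [mul_left_comm _ c, ← Finset.mul_sum, ha] }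
  obtain ⟨e₁⟩ := nonempty_homeomorph_sphere_bundle K F G hF hG hGF hFK hFG
  obtain ⟨e₂⟩ := nonempty_homeomorph_sph (ι := ZMod p) (m := 2 * p - 1) (by rw [ZMod.card]; omega)
  obtain ⟨e₃⟩ := nonempty_homeomorph_sph (ι := Fin (p - 1)) (m := 2 * p - 3)
    (by rw [Fintype.card_fin]; omega)
  let ρ (g : P) (v : EuclideanSpace ℂ (ZMod p)) : EuclideanSpace ℂ (ZMod p) :=
    WithLp.toLp 2 fun t => ZMod.stdAddChar (z g + y g * t) * v (t + x g)
  have hρ_norm (g : P) (v : EuclideanSpace ℂ (ZMod p)) : ‖ρ g v‖ = ‖v‖ := by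
    simp only [EuclideanSpace.norm_eq, ρ, norm_mul, AddChar.norm_apply, one_mul]
    exact congrArg Real.sqrt (Equiv.sum_comp (Equiv.addRight (x g)) fun t => ‖v t‖ ^ 2)
  have hρ_cont (g : P) : Continuous (ρ g) :=
    (PiLp.continuous_toLp 2 _).comp (by fun_prop)
  have hρ_mul (g h : P) (v : EuclideanSpace ℂ (ZMod p)) : ρ (g * h) v = ρ g (ρ h v) := by
    ext t
    simp only [ρ]
    rw [← mul_assoc, ← AddChar.map_add_eq_mul, hx, hy, hz]
    ring_nf
  have hρ_one (v : EuclideanSpace ℂ (ZMod p)) : ρ 1 v = v := by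
    have hx1 : x 1 = 0 := by simpa using hx 1 1
    have hy1 : y 1 = 0 := by simpa using hy 1 1
    have hz1 : z 1 = 0 := by simpa [hx1] using hz 1 1
    ext t
    simp [ρ, hx1, hy1, hz1]
  have hψ (s : ZMod p) : (ZMod.stdAddChar s : ℂ) ^ (k + 1) = 1 := by
    rw [← AddChar.map_nsmul_eq_pow, nsmul_eq_mul]; push_cast; simp [hk1]
  have hρ_sum (g : P) (v w : EuclideanSpace ℂ (ZMod p)) :
      ∑ t, ρ g v t ^ k * ρ g w t = ∑ t, v t ^ k * w t := by
    rw [← Equiv.sum_comp (Equiv.addRight (x g)) fun t => v t ^ k * w t]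
    refine Finset.sum_congr rfl fun t _ => ?_
    simp only [ρ, Equiv.coe_addRight, mul_pow]
    linear_combination (v (t + x g) ^ k * w (t + x g)) * hψ (z g + y g * t)
  let σ (g : P) (v : sphere (0 : EuclideanSpace ℂ (ZMod p)) 1) :
      sphere (0 : EuclideanSpace ℂ (ZMod p)) 1 :=
    ⟨ρ g v, by rw [mem_sphere_zero_iff_norm, hρ_norm, norm_eq_of_mem_sphere]⟩
  have hσ_cont (g : P) : Continuous (σ g) :=
    ((hρ_cont g).comp continuous_subtype_val).subtype_mk _
  have hσ_mul (g h : P) (v : sphere (0 : EuclideanSpace ℂ (ZMod p)) 1) :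
      σ (g * h) v = σ g (σ h v) :=
    Subtype.ext (hρ_mul g h v)
  have hσ_one (v : sphere (0 : EuclideanSpace ℂ (ZMod p)) 1) : σ 1 v = v := Subtype.ext (hρ_one v)
  refine exists_free_hom_of_homeomorph ((e₂.prodCongr e₃).trans e₁)
    (fun g q => ⟨(σ g q.1.1, σ g q.1.2), (hρ_sum g q.1.1 q.1.2).trans q.2⟩) (fun g => ?_)
    (fun q => ?_) (fun g h q => ?_) fun g q hq => ?_
  · have := hσ_cont g
    fun_prop
  · exact Subtype.ext (Prod.ext (hσ_one _) (hσ_one _))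
  · exact Subtype.ext (Prod.ext (hσ_mul _ _ _) (hσ_mul _ _ _))
  · have hv : ρ g q.1.1 = q.1.1 := congrArg (fun q => (q.1.1 : EuclideanSpace ℂ (ZMod p))) hq
    have hw : ρ g q.1.2 = q.1.2 := congrArg (fun q => (q.1.2 : EuclideanSpace ℂ (ZMod p))) hq
    have hne (v : sphere (0 : EuclideanSpace ℂ (ZMod p)) 1) : (v.1 : ZMod p → ℂ) ≠ 0 := fun h =>
      ne_zero_of_mem_unit_sphere v (by ext t; exact congrFun h t)
    obtain ⟨h1, h2, h3⟩ := heisenberg_stabilizer_trivial hk1 (hne q.1.1) (hne q.1.2)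
      (fun t => congrArg (fun u : EuclideanSpace ℂ (ZMod p) => u t) hv)
      (fun t => congrArg (fun u : EuclideanSpace ℂ (ZMod p) => u t) hw) q.2
    exact hxyz g h1 h2 h3
end

section
/- Let p be a prime, r ≥ 0, and G = (ℤ/p)^r. Let C₁ and C₀ be finitely generated free modules over the group algebra 𝔽_p[G], and let d : C₁ → C₀ be an 𝔽_p[G]-module homomorphism (a 1-dimensional chain complex of free 𝔽_p G-modules). Suppose the complex is connected, i.e., the cokernel of d is one-dimensional over 𝔽_p (so H₀ ≅ 𝔽_p). Then dim_{𝔽_p}(ker d) + dim_{𝔽_p}(coker d) ≥ 2^r. -/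
/-- The group algebra `𝔽_p[(ℤ/p)^r]`. -/
abbrev GroupAlg (p r : ℕ) : Type :=
  MonoidAlgebra (ZMod p) (Multiplicative (Fin r → ZMod p))

open Module in
/-- If `range d` is the kernel of a nonzero functional, then the determinant of `d` divides every
scalar that kills the cokernel of `d`. -/
lemma LinearMap.det_toMatrix_dvd_of_smul_mem_range {k A C₁ C₀ ι : Type*} [Field k] [CommRing A]
    [Algebra k A] [AddCommGroup C₁] [AddCommGroup C₀] [Module A C₁] [Module A C₀]
    [Module k C₀] [IsScalarTower k A C₀] [Fintype ι] [DecidableEq ι]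
    (b₁ : Basis ι A C₁) (b₀ : Basis ι A C₀) (d : C₁ →ₗ[A] C₀) (φ : C₀ →ₗ[k] k) (hφ₀ : φ ≠ 0)
    (hφ : ∀ x, φ x = 0 ↔ x ∈ LinearMap.range d) (a : A) (ha : ∀ x, a • x ∈ LinearMap.range d) :
    (LinearMap.toMatrix b₁ b₀ d).det ∣ a := by
  obtain ⟨j, hj⟩ : ∃ j, φ (b₀ j) ≠ 0 := by
    by_contra! h
    refine hφ₀ (LinearMap.ext fun x => (hφ x).2 ?_)
    have hspan : Submodule.span A (Set.range b₀) ≤ LinearMap.range d := by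
      rw [Submodule.span_le]
      rintro _ ⟨i, rfl⟩
      exact (hφ _).1 (h i)
    exact hspan (b₀.span_eq ▸ Submodule.mem_top)
  set w : ι → A := fun i => if i = j then a else - algebraMap k A (φ (b₀ i) / φ (b₀ j)) with hw
  set y : ι → C₀ := fun i => (if i = j then 0 else b₀ i) + w i • b₀ j with hy
  have hyd : ∀ i, ∃ x, d x = y i := by
    intro i
    by_cases hi : i = j
    · simpa [hy, hw, hi] using ha (b₀ j)
    · refine (hφ _).1 ?_
      simp [hy, hw, hi, hj, algebraMap_smul]
  choose x hx using hyd
  have hmat : LinearMap.toMatrix b₁ b₀ d * LinearMap.toMatrix b₀ b₁ (b₀.constr A x) =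
      (1 : Matrix ι ι A).updateRow j w := by
    rw [← LinearMap.toMatrix_comp]
    ext i l
    rw [LinearMap.toMatrix_apply]
    simp only [LinearMap.comp_apply, Basis.constr_basis, hx, hy]
    by_cases hi : i = j
    · subst hi
      by_cases hl : l = i <;> simp [hl]
    · by_cases hl : l = j
      · subst hl
        simp [hi]
      · simp [hi, hl, Matrix.one_apply, Finsupp.single_apply, eq_comm]
  have hdet := congrArg Matrix.det hmat
  rw [Matrix.det_mul, ← Matrix.cramer_transpose_apply, Matrix.transpose_one,
    Matrix.cramer_one] at hdet
  exact ⟨_, by simpa [hw] using hdet.symm⟩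

open Module in
lemma LinearMap.det_toMatrix_smul_mem_range {A C₁ C₀ ι : Type*} [CommRing A]
    [AddCommGroup C₁] [AddCommGroup C₀] [Module A C₁] [Module A C₀] [Fintype ι] [DecidableEq ι]
    (b₁ : Basis ι A C₁) (b₀ : Basis ι A C₀) (d : C₁ →ₗ[A] C₀) (x : C₀) :
    (LinearMap.toMatrix b₁ b₀ d).det • x ∈ LinearMap.range d := by
  set M := LinearMap.toMatrix b₁ b₀ d with hM
  refine ⟨Matrix.toLin b₀ b₁ M.adjugate x, ?_⟩
  have h := Matrix.toLin_mul b₀ b₁ b₀ M M.adjugate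
  rw [Matrix.mul_adjugate, hM, Matrix.toLin_toMatrix, ← hM] at h
  have := LinearMap.congr_fun h x
  simpa using this.symm

/-- If every element of `A` is a scalar modulo a multiple of `f`, and `f ^ n = 0`, then the first
`n` powers of `f` span `A`. -/
lemma finrank_le_of_forall_dvd_sub_algebraMap {k A : Type*} [Field k] [CommRing A] [Algebra k A]
    (f : A) (n : ℕ) (hf : f ^ n = 0) (h : ∀ a : A, ∃ c : k, f ∣ a - algebraMap k A c) :
    Module.finrank k A ≤ n := by
  have key : ∀ m (a : A), ∃ s ∈ Submodule.span k (Set.range fun i : Fin m => f ^ (i : ℕ)),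
      f ^ m ∣ a - s := by
    intro m
    induction m with
    | zero => exact fun a => ⟨0, zero_mem _, by simp⟩
    | succ m ih =>
      intro a
      obtain ⟨s, hs, b, hb⟩ := ih a
      obtain ⟨c, e, he⟩ := h b
      refine ⟨s + c • f ^ m, add_mem (Submodule.span_mono ?_ hs) (Submodule.smul_mem _ _
        (Submodule.subset_span ⟨Fin.last m, by simp⟩)), e, ?_⟩
      · rintro _ ⟨i, rfl⟩
        exact ⟨i.castSucc, by simp⟩
      · rw [Algebra.smul_def]
        linear_combination hb + f ^ m * he
  have htop : Submodule.span k (Set.range fun i : Fin n => f ^ (i : ℕ)) = ⊤ := by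
    refine eq_top_iff.2 fun a _ => ?_
    obtain ⟨s, hs, hd⟩ := key n a
    rw [hf, zero_dvd_iff, sub_eq_zero] at hd
    exact hd ▸ hs
  have hle := finrank_range_le_card (R := k) (fun i : Fin n => f ^ (i : ℕ))
  rwa [Set.finrank, htop, finrank_top, Fintype.card_fin] at hle

lemma MonoidAlgebra.exists_pow_char_eq_algebraMap {k G : Type*} [Field k] [CommGroup G] (p : ℕ)
    [Fact p.Prime] [CharP k p] (hG : ∀ g : G, g ^ p = 1) (a : MonoidAlgebra k G) :
    ∃ c : k, a ^ p = algebraMap k (MonoidAlgebra k G) c := by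
  have : CharP (MonoidAlgebra k G) p := charP_of_injective_algebraMap' k p
  induction a using MonoidAlgebra.induction_linear with
  | zero => exact ⟨0, by simp [(Fact.out : p.Prime).ne_zero]⟩
  | add a b ha hb =>
    obtain ⟨c, hc⟩ := ha
    obtain ⟨e, he⟩ := hb
    exact ⟨c + e, by rw [add_pow_char, hc, he, map_add]⟩
  | single g c => exact ⟨c ^ p, by simp [MonoidAlgebra.single_pow, hG]⟩

/-- A square matrix over a commutative `k`-algebra `A` in which all `p`-th powers are scalars can
have one-dimensional cokernel only if `A` has dimension at most `p`. -/
lemma finrank_le_of_finrank_quotient_range_eq_one {k A C₁ C₀ : Type*} [Field k] [CommRing A]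
    [Algebra k A] [Nontrivial A] [AddCommGroup C₁] [AddCommGroup C₀] [Module A C₁] [Module A C₀]
    [Module.Free A C₁] [Module.Finite A C₁] [Module.Free A C₀] [Module.Finite A C₀]
    [Module k C₀] [IsScalarTower k A C₀] (p : ℕ)
    (hA : ∀ a : A, ∃ c : k, a ^ p = algebraMap k A c) (d : C₁ →ₗ[A] C₀)
    (hrank : Module.finrank A C₁ = Module.finrank A C₀)
    (hd : Module.finrank k (C₀ ⧸ (LinearMap.range d).restrictScalars k) = 1) (hp : p ≠ 0) :
    Module.finrank k A ≤ p := by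
  let N := (LinearMap.range d).restrictScalars k
  have : Module.Finite k (C₀ ⧸ N) := Module.finite_of_finrank_eq_succ hd
  let e : (C₀ ⧸ N) ≃ₗ[k] k := LinearEquiv.ofFinrankEq _ _ (hd.trans (Module.finrank_self k).symm)
  let φ : C₀ →ₗ[k] k := e.toLinearMap ∘ₗ N.mkQ
  have hφ : ∀ x, φ x = 0 ↔ x ∈ LinearMap.range d := by
    intro x
    simp [φ, N]
  obtain ⟨u, hu⟩ : ∃ u, φ u = 1 := (e.surjective.comp N.mkQ_surjective) 1
  have hφ₀ : φ ≠ 0 := fun h => by simp [h] at hu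
  let b₁ := (Module.finBasis A C₁).reindex (finCongr hrank)
  let b₀ := Module.finBasis A C₀
  let f := (LinearMap.toMatrix b₁ b₀ d).det
  have hfmem : ∀ x, f • x ∈ LinearMap.range d := LinearMap.det_toMatrix_smul_mem_range b₁ b₀ d
  refine finrank_le_of_forall_dvd_sub_algebraMap f p ?_ fun a => ⟨φ (a • u), ?_⟩
  · obtain ⟨c, hc⟩ := hA f
    have hmem : f ^ p • u ∈ LinearMap.range d := by
      obtain ⟨n, rfl⟩ := Nat.exists_eq_succ_of_ne_zero hp
      rw [pow_succ', mul_smul]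
      exact hfmem _
    rw [hc, algebraMap_smul, ← hφ, map_smul, hu, smul_eq_mul, mul_one] at hmem
    rw [hc, hmem, map_zero]
  · refine LinearMap.det_toMatrix_dvd_of_smul_mem_range b₁ b₀ d φ hφ₀ hφ _ fun x => ?_
    have hx : a • (x - φ x • u) ∈ LinearMap.range d :=
      Submodule.smul_mem _ _ ((hφ _).1 (by simp [hu]))
    rw [← hφ, smul_sub, smul_comm, map_sub, φ.map_smul, sub_eq_zero] at hx
    rw [← hφ, sub_smul, algebraMap_smul, map_sub, φ.map_smul, hx, smul_eq_mul, smul_eq_mul,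
      mul_comm, sub_self]

/-- **Adem–Swan theorem** (the 1-dimensional case of Carlsson's conjecture).
Let `G = (ℤ/p)^r` and let `d : C₁ → C₀` be a map of finitely generated free
`𝔽_p[G]`-modules, viewed as a 1-dimensional free chain complex. If the complex is
connected, i.e. `H₀ = coker d` is 1-dimensional over `𝔽_p`, then
`dim_{𝔽_p} H₁ + dim_{𝔽_p} H₀ = dim_{𝔽_p} (ker d) + dim_{𝔽_p} (coker d) ≥ 2^r`. -/
theorem adem_swan_one_dimensional_carlsson_conjecture
    (p : ℕ) (hp : p.Prime) (r : ℕ)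
    (C₁ C₀ : Type) [AddCommGroup C₁] [AddCommGroup C₀]
    [Module (GroupAlg p r) C₁] [Module (GroupAlg p r) C₀]
    [Module.Free (GroupAlg p r) C₁] [Module.Finite (GroupAlg p r) C₁]
    [Module.Free (GroupAlg p r) C₀] [Module.Finite (GroupAlg p r) C₀]
    [Module (ZMod p) C₁] [Module (ZMod p) C₀]
    [IsScalarTower (ZMod p) (GroupAlg p r) C₁] [IsScalarTower (ZMod p) (GroupAlg p r) C₀]
    (d : C₁ →ₗ[GroupAlg p r] C₀)
    (hconn : Module.finrank (ZMod p)
      (C₀ ⧸ (LinearMap.range d).restrictScalars (ZMod p)) = 1) :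
    2 ^ r ≤ Module.finrank (ZMod p) ((LinearMap.ker d).restrictScalars (ZMod p)) +
      Module.finrank (ZMod p) (C₀ ⧸ (LinearMap.range d).restrictScalars (ZMod p)) := by
  have : Fact p.Prime := ⟨hp⟩
  have hA : Module.finrank (ZMod p) (GroupAlg p r) = p ^ r := by
    rw [Module.finrank_eq_card_basis (MonoidAlgebra.basis _ _)]
    simp
  have : Module.Finite (ZMod p) (GroupAlg p r) := Module.Finite.of_basis (MonoidAlgebra.basis _ _)
  have : Module.Finite (ZMod p) C₁ := Module.Finite.trans (GroupAlg p r) C₁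
  have : Module.Finite (ZMod p) C₀ := Module.Finite.trans (GroupAlg p r) C₀
  have h₁ := Module.finrank_mul_finrank (ZMod p) (GroupAlg p r) C₁
  have h₀ := Module.finrank_mul_finrank (ZMod p) (GroupAlg p r) C₀
  have hquot := ((LinearMap.range d).restrictScalars (ZMod p)).finrank_quotient_add_finrank
  have hker : Module.finrank (ZMod p) ((LinearMap.range d).restrictScalars (ZMod p)) +
      Module.finrank (ZMod p) ((LinearMap.ker d).restrictScalars (ZMod p)) =
        Module.finrank (ZMod p) C₁ :=
    (d.restrictScalars (ZMod p)).finrank_range_add_finrank_ker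
  have hsquare := finrank_le_of_finrank_quotient_range_eq_one (k := ZMod p) p
    (MonoidAlgebra.exists_pow_char_eq_algebraMap p fun g => by
      ext i
      simp) d
  rw [hA] at h₀ h₁ hsquare
  rw [hconn] at hquot ⊢
  rcases Nat.eq_zero_or_pos r with rfl | hr
  · simp
  have hpr : 2 ^ r ≤ p ^ r := Nat.pow_le_pow_left hp.two_le r
  have h2r : 2 ≤ 2 ^ r := by simpa using Nat.pow_le_pow_right (n := 2) two_pos hr
  have hle : Module.finrank (GroupAlg p r) C₀ ≤ Module.finrank (GroupAlg p r) C₁ := by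
    by_contra! hlt
    have := Nat.mul_le_mul_left (p ^ r) (Nat.succ_le_of_lt hlt)
    rw [Nat.mul_succ] at this
    omega
  rcases hle.eq_or_lt with heq | hlt
  · have hone : r ≤ 1 := by
      have := hsquare heq.symm hconn hp.ne_zero
      exact (Nat.pow_le_pow_iff_right hp.one_lt).1 (by simpa using this)
    obtain rfl : r = 1 := by omega
    rw [heq] at h₀
    omega
  · have := Nat.mul_le_mul_left (p ^ r) (Nat.succ_le_of_lt hlt)
    rw [Nat.mul_succ] at this
    omega
end
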